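/- Let ℓ satisfy Assumption A, let L be the two-dimensional coordinate-decoupled classification objective with minimizer w* = (w₁*, w₂*), w₁* > w₂* > 0, let p = (w₂*, −w₁*), let q ∈ ℝ² be a nonzero vector with qᵀw* ≥ 0, let c₁, c₂ > 0 be constants, and define the perturbed objective L_ε(w) = L(w) + c₁ ℓ_{1,ε}(w) + c₂ ℓ_{2,ε}(w), where ℓ_{1,ε}(w) = ε² ℓ(−wᵀp/ε²) (and max{−wᵀp, 0} at ε = 0) and ℓ_{2,ε}(w) = ε² ℓ(−wᵀq/ε²) (and max{−wᵀq, 0} at ε = 0). Then L_ε is strictly convex for every ε, its unique minimizer w*_ε, viewed as a function of ε, is continuous on all of ℝ, and it is continuously differentiable at every ε ≠ 0 as well as in a neighborhood of ε = 0 obtained via the implicit function theorem (with w*_0 = w*). -/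

import Mathlib

open Filter Topology

/-- Assumption A on the individual loss function `ℓ`:
(i) `ℓ` is nonnegative, three-times continuously differentiable, strictly convex,
and tends to `0` at `-∞`;
(ii) `ℓ'` tends to `0` at `-∞` and to `1` at `+∞`;
(iii) `ℓ''` is increasing on `(-∞, 0]`, decreasing on `[0, ∞)`, and
`(1/ε²)·ℓ''(1/ε) → 0` as `ε → 0`. -/
structure AssumptionA (ℓ : ℝ → ℝ) : Prop where
  nonneg : ∀ z, 0 ≤ ℓ z
  smooth : ContDiff ℝ 3 ℓ
  strictConvex : StrictConvexOn ℝ Set.univ ℓ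
  tendsto_zero_atBot : Tendsto ℓ atBot (𝓝 0)
  deriv_tendsto_zero_atBot : Tendsto (deriv ℓ) atBot (𝓝 0)
  deriv_tendsto_one_atTop : Tendsto (deriv ℓ) atTop (𝓝 1)
  secondDeriv_strictMono : StrictMonoOn (deriv (deriv ℓ)) (Set.Iic 0)
  secondDeriv_strictAnti : StrictAntiOn (deriv (deriv ℓ)) (Set.Ici 0)
  secondDeriv_decay :
    Tendsto (fun ε : ℝ => (1 / ε ^ 2) * deriv (deriv ℓ) (1 / ε)) (𝓝[≠] (0 : ℝ)) (𝓝 0)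

/-- The Euclidean dot product on `ℝ × ℝ`. -/
def dot (w v : ℝ × ℝ) : ℝ := w.1 * v.1 + w.2 * v.2

theorem contDiff_one_of_tendsto_deriv {E : Type*} [NormedAddCommGroup E] [NormedSpace ℝ E]
    {f : ℝ → E} {a : ℝ} {f' : E} (hf : ∀ x, x ≠ a → ContDiffAt ℝ 1 f x)
    (ha : ContinuousAt f a) (hf' : Tendsto (deriv f) (𝓝[≠] a) (𝓝 f')) : ContDiff ℝ 1 f := by
  have hda : HasDerivAt f f' a := by
    have h := hasDerivAt_of_hasDerivAt_of_ne (f := f) (g := Function.update (deriv f) a f')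
      (x := a) (fun y hy => by
        rw [Function.update_of_ne hy]
        exact ((hf y hy).differentiableAt one_ne_zero).hasDerivAt) ha
      (continuousAt_update_same.2 hf')
    simpa using h
  rw [contDiff_one_iff_deriv]
  refine ⟨fun x => ?_, continuous_iff_continuousAt.2 fun x => ?_⟩
  · rcases eq_or_ne x a with rfl | hx
    · exact hda.differentiableAt
    · exact (hf x hx).differentiableAt one_ne_zero
  · rcases eq_or_ne x a with rfl | hx
    · rw [continuousAt_iff_punctured_nhds, hda.deriv]
      exact hf'
    · have h := ((hf x hx).fderiv_right (m := 0) le_rfl).continuousAt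
      exact h.clm_apply continuousAt_const

theorem tendsto_nhds_of_tendsto_isMin {X ι : Type*} [TopologicalSpace X]
    {f : X → ℝ} (hf : Continuous f) (hc : Tendsto f (cocompact X) atTop) {x₀ : X}
    (huniq : ∀ x, f x = f x₀ → x = x₀) {l : Filter ι} {u : ι → X}
    (hu : Tendsto (fun i => f (u i)) l (𝓝 (f x₀))) : Tendsto u l (𝓝 x₀) := by
  obtain ⟨K, hK, hKf⟩ := mem_cocompact.1 (hc (Ioi_mem_atTop (f x₀ + 1)))
  refine hK.tendsto_nhds_of_unique_mapClusterPt ?_ fun y _ hy => huniq y ?_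
  · filter_upwards [hu (Iio_mem_nhds (lt_add_one (f x₀)))] with i hi
    by_contra hni
    exact lt_asymm (show f x₀ + 1 < f (u i) from hKf hni) hi
  · by_contra hne
    have h := hy.continuousAt_comp hf.continuousAt
    exact hne (eq_of_nhds_neBot (h.neBot.mono (inf_le_inf_left _ hu)))

namespace AssumptionA

variable {ℓ : ℝ → ℝ} (hA : AssumptionA ℓ)
include hA

theorem hasDerivAt (x : ℝ) : HasDerivAt ℓ (deriv ℓ x) x :=
  (hA.smooth.differentiable (by norm_num) x).hasDerivAt

theorem contDiff_deriv : ContDiff ℝ 1 (deriv ℓ) :=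
  (hA.smooth.of_le (m := 1 + 1) (by norm_num)).deriv'

theorem hasDerivAt_deriv (x : ℝ) : HasDerivAt (deriv ℓ) (deriv (deriv ℓ) x) x :=
  (hA.contDiff_deriv.differentiable one_ne_zero x).hasDerivAt

theorem continuous_secondDeriv : Continuous (deriv (deriv ℓ)) :=
  hA.contDiff_deriv.continuous_deriv le_rfl

theorem strictMono_deriv : StrictMono (deriv ℓ) :=
  strictMonoOn_univ.1 (hA.strictConvex.strictMonoOn_deriv fun x _ =>
    (hA.hasDerivAt x).differentiableAt)

theorem secondDeriv_nonneg (x : ℝ) : 0 ≤ deriv (deriv ℓ) x :=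
  hA.strictMono_deriv.monotone.deriv_nonneg

theorem secondDeriv_pos (x : ℝ) : 0 < deriv (deriv ℓ) x := by
  rcases le_total x 0 with hx | hx
  · exact (hA.secondDeriv_nonneg (x - 1)).trans_lt
      (hA.secondDeriv_strictMono (show x - 1 ≤ 0 by linarith) hx (by linarith))
  · exact (hA.secondDeriv_nonneg (x + 1)).trans_lt
      (hA.secondDeriv_strictAnti hx (show 0 ≤ x + 1 by linarith) (by linarith))

theorem deriv_pos (x : ℝ) : 0 < deriv ℓ x :=
  (hA.strictMono_deriv.monotone.le_of_tendsto hA.deriv_tendsto_zero_atBot (x - 1)).trans_lt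
    (hA.strictMono_deriv (sub_one_lt x))

theorem add_deriv_mul_le (x y : ℝ) : ℓ x + deriv ℓ x * (y - x) ≤ ℓ y := by
  rcases lt_trichotomy x y with h | rfl | h
  · have := hA.strictConvex.convexOn.le_slope_of_hasDerivAt trivial trivial h (hA.hasDerivAt x)
    rw [slope_def_field, le_div_iff₀ (by linarith)] at this
    linarith
  · simp
  · have := hA.strictConvex.convexOn.slope_le_of_hasDerivAt trivial trivial h (hA.hasDerivAt x)
    rw [slope_def_field, div_le_iff₀ (by linarith)] at this
    linarith

theorem monotone : Monotone ℓ :=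
  monotone_of_deriv_nonneg (fun x => (hA.hasDerivAt x).differentiableAt)
    fun x => (hA.deriv_pos x).le

theorem tendsto_atBot_of_tendsto_deriv {ι : Type*} {l : Filter ι} {u : ι → ℝ}
    (hu : Tendsto (fun i => deriv ℓ (u i)) l (𝓝 0)) : Tendsto u l atBot := by
  refine tendsto_atBot.2 fun b => ?_
  filter_upwards [hu (Iio_mem_nhds (hA.deriv_pos b))] with i hi
  exact (hA.strictMono_deriv.lt_iff_lt.1 hi).le

theorem tendsto_secondDeriv_mul_sq :
    Tendsto (fun z => deriv (deriv ℓ) z * z ^ 2) atBot (𝓝 0) := by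
  have h := hA.secondDeriv_decay.comp
    (tendsto_inv_atBot_nhdsLT_zero.mono_right (nhdsWithin_mono _ fun x hx => ne_of_lt hx))
  refine h.congr fun z => ?_
  simp [mul_comm]

theorem exists_linear_lower_bound : ∃ C, 0 ≤ C ∧ ∀ z, (z - C) / 2 ≤ ℓ z := by
  obtain ⟨a, ha⟩ := 
    (hA.deriv_tendsto_one_atTop.eventually_const_lt (show (1 / 2 : ℝ) < 1 by norm_num)).exists
  refine ⟨max a 0, le_max_right _ _, fun z => ?_⟩
  have h0 := hA.nonneg z
  rcases le_total z (max a 0) with hz | hz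
  · linarith
  · have h1 := hA.add_deriv_mul_le a z
    have h2 := hA.nonneg a
    have h3 : a ≤ max a 0 := le_max_left _ _
    nlinarith

end AssumptionA

theorem dot_add_left (v w p : ℝ × ℝ) : dot (v + w) p = dot v p + dot w p := by
  simp only [dot, Prod.fst_add, Prod.snd_add]; ring

theorem dot_smul_left (a : ℝ) (v p : ℝ × ℝ) : dot (a • v) p = a * dot v p := by
  simp only [dot, Prod.smul_fst, Prod.smul_snd, smul_eq_mul]; ring

theorem continuous_dot_left (p : ℝ × ℝ) : Continuous fun w => dot w p := by
  unfold dot; fun_prop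

/-- Derivative of `-h` composed with the ridge argument, along a curve `(e, w)` with
velocity `(e', w')`. -/
noncomputable def ridgeRate (h : ℝ → ℝ) (e e' : ℝ) (w w' p : ℝ × ℝ) : ℝ :=
  h (-(dot w p) / e ^ 2) * (dot w' p / e ^ 2 - 2 * (dot w p / e ^ 2) * e' / e)

/-- The `w`-gradient of the perturbed objective at `(ε, w)`, in terms of `g = ℓ'`. -/
noncomputable def gradField (g : ℝ → ℝ) (a₁ b₁ a₂ b₂ c₁ c₂ : ℝ) (p q : ℝ × ℝ)
    (x : ℝ × (ℝ × ℝ)) : ℝ × ℝ :=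
  (b₁ * g x.2.1 - a₁ * g (-x.2.1) - c₁ * p.1 * g (-(dot x.2 p) / x.1 ^ 2)
      - c₂ * q.1 * g (-(dot x.2 q) / x.1 ^ 2),
    b₂ * g x.2.2 - a₂ * g (-x.2.2) - c₁ * p.2 * g (-(dot x.2 p) / x.1 ^ 2)
      - c₂ * q.2 * g (-(dot x.2 q) / x.1 ^ 2))

/-- The rate of change of `gradField` along a curve `(e, w)` with velocity `(e', w')`, in terms
of `h = ℓ''`. -/
noncomputable def gradRate (h : ℝ → ℝ) (a₁ b₁ a₂ b₂ c₁ c₂ : ℝ) (p q : ℝ × ℝ)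
    (e e' : ℝ) (w w' : ℝ × ℝ) : ℝ × ℝ :=
  ((b₁ * h w.1 + a₁ * h (-w.1)) * w'.1 + c₁ * p.1 * ridgeRate h e e' w w' p
      + c₂ * q.1 * ridgeRate h e e' w w' q,
    (b₂ * h w.2 + a₂ * h (-w.2)) * w'.2 + c₁ * p.2 * ridgeRate h e e' w w' p
      + c₂ * q.2 * ridgeRate h e e' w w' q)

theorem hasDerivAt_ridge {g h : ℝ → ℝ} (hg : ∀ x, HasDerivAt g (h x) x) {e : ℝ → ℝ}
    {w : ℝ → ℝ × ℝ} {e' τ : ℝ} {w' : ℝ × ℝ} (he : HasDerivAt e e' τ) (hw : HasDerivAt w w' τ)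
    (he0 : e τ ≠ 0) (p : ℝ × ℝ) :
    HasDerivAt (fun t => g (-(dot (w t) p) / e t ^ 2)) (-ridgeRate h (e τ) e' (w τ) w' p) τ := by
  have hw1 : HasDerivAt (fun t => (w t).1) w'.1 τ := hw.fst
  have hw2 : HasDerivAt (fun t => (w t).2) w'.2 τ := hw.snd
  have hd : HasDerivAt (fun t => dot (w t) p) (dot w' p) τ :=
    (hw1.mul_const p.1).add (hw2.mul_const p.2)
  have h1 := hd.neg.div (he.pow 2) (pow_ne_zero 2 he0)
  refine ((hg _).comp τ h1).congr_deriv ?_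
  simp only [ridgeRate, Pi.pow_apply, Pi.neg_apply, Pi.div_apply]
  rw [← mul_neg]
  congr 1
  field_simp
  ring

theorem hasDerivAt_gradField {g h : ℝ → ℝ} (hg : ∀ x, HasDerivAt g (h x) x)
    (a₁ b₁ a₂ b₂ c₁ c₂ : ℝ) (p q : ℝ × ℝ) {e : ℝ → ℝ}
    {w : ℝ → ℝ × ℝ} {e' τ : ℝ} {w' : ℝ × ℝ} (he : HasDerivAt e e' τ) (hw : HasDerivAt w w' τ)
    (he0 : e τ ≠ 0) :
    HasDerivAt (fun t => gradField g a₁ b₁ a₂ b₂ c₁ c₂ p q (e t, w t))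
      (gradRate h a₁ b₁ a₂ b₂ c₁ c₂ p q (e τ) e' (w τ) w') τ := by
  have hp := hasDerivAt_ridge hg he hw he0 p
  have hq := hasDerivAt_ridge hg he hw he0 q
  have hcoord (a b x y : ℝ) {u : ℝ → ℝ} {u' : ℝ} (hu : HasDerivAt u u' τ) :
      HasDerivAt (fun t => b * g (u t) - a * g (-u t) - c₁ * x * g (-(dot (w t) p) / e t ^ 2)
          - c₂ * y * g (-(dot (w t) q) / e t ^ 2))
        ((b * h (u τ) + a * h (-u τ)) * u' + c₁ * x * ridgeRate h (e τ) e' (w τ) w' p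
          + c₂ * y * ridgeRate h (e τ) e' (w τ) w' q) τ := by
    have h1 := ((hg (u τ)).comp τ hu).const_mul b
    have h2 := ((hg (-u τ)).comp τ hu.neg).const_mul a
    refine (((h1.sub h2).sub (hp.const_mul (c₁ * x))).sub (hq.const_mul (c₂ * y))).congr_deriv ?_
    ring
  exact (hcoord a₁ b₁ p.1 q.1 hw.fst).prodMk (hcoord a₂ b₂ p.2 q.2 hw.snd)

theorem hessian_energy_le {h : ℝ → ℝ} (hh : ∀ x, 0 < h x) {a₁ b₁ a₂ b₂ c₁ c₂ : ℝ}
    (hc₁ : 0 < c₁) (hc₂ : 0 < c₂) {p q : ℝ × ℝ} {e e' : ℝ} {w w' : ℝ × ℝ}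
    (hrate : gradRate h a₁ b₁ a₂ b₂ c₁ c₂ p q e e' w w' = 0) :
    (b₁ * h w.1 + a₁ * h (-w.1)) * w'.1 ^ 2 + (b₂ * h w.2 + a₂ * h (-w.2)) * w'.2 ^ 2 ≤
      e' ^ 2 * (c₁ * (h (-(dot w p) / e ^ 2) * (-(dot w p) / e ^ 2) ^ 2)
        + c₂ * (h (-(dot w q) / e ^ 2) * (-(dot w q) / e ^ 2) ^ 2)) := by
  have h1 := congrArg Prod.fst hrate
  have h2 := congrArg Prod.snd hrate
  simp only [gradRate, Prod.fst_zero, Prod.snd_zero] at h1 h2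
  have key (r : ℝ × ℝ) : -(e' ^ 2 * (h (-(dot w r) / e ^ 2) * (-(dot w r) / e ^ 2) ^ 2)) ≤
      dot w' r * ridgeRate h e e' w w' r := by
    have hpos := (hh (-(dot w r) / e ^ 2)).le
    have hid : dot w' r * ridgeRate h e e' w w' r
        + e' ^ 2 * (h (-(dot w r) / e ^ 2) * (-(dot w r) / e ^ 2) ^ 2)
        = h (-(dot w r) / e ^ 2) * (dot w' r / e - dot w r / e ^ 2 * e') ^ 2 := by
      rw [ridgeRate]; ring
    have := mul_nonneg hpos (sq_nonneg (dot w' r / e - dot w r / e ^ 2 * e'))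
    linarith
  have hp := mul_le_mul_of_nonneg_left (key p) hc₁.le
  have hq := mul_le_mul_of_nonneg_left (key q) hc₂.le
  have hdp : dot w' p = w'.1 * p.1 + w'.2 * p.2 := rfl
  have hdq : dot w' q = w'.1 * q.1 + w'.2 * q.2 := rfl
  rw [hdp] at hp
  rw [hdq] at hq
  linear_combination hp + hq + w'.1 * h1 + w'.2 * h2

theorem contDiffAt_gradField {g : ℝ → ℝ} (hg : ContDiff ℝ 1 g) (a₁ b₁ a₂ b₂ c₁ c₂ : ℝ)
    (p q : ℝ × ℝ) {x : ℝ × (ℝ × ℝ)} (hx : x.1 ≠ 0) :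
    ContDiffAt ℝ 1 (gradField g a₁ b₁ a₂ b₂ c₁ c₂ p q) x := by
  have hne : x.1 ^ 2 ≠ 0 := pow_ne_zero 2 hx
  have hridge (r : ℝ × ℝ) :
      ContDiffAt ℝ 1 (fun y : ℝ × (ℝ × ℝ) => g (-(dot y.2 r) / y.1 ^ 2)) x := by
    refine hg.contDiffAt.comp x (ContDiffAt.div ?_ ?_ hne)
    · unfold dot; fun_prop
    · fun_prop
  have hcoord (a b s t : ℝ) {u : ℝ × (ℝ × ℝ) → ℝ} (hu : ContDiff ℝ 1 u) :
      ContDiffAt ℝ 1 (fun y => b * g (u y) - a * g (-u y) - c₁ * s * g (-(dot y.2 p) / y.1 ^ 2)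
        - c₂ * t * g (-(dot y.2 q) / y.1 ^ 2)) x :=
    (ContDiffAt.sub (by fun_prop) (contDiffAt_const.mul (hridge p))).sub
      (contDiffAt_const.mul (hridge q))
  exact (hcoord a₁ b₁ p.1 q.1 (by fun_prop)).prodMk (hcoord a₂ b₂ p.2 q.2 (by fun_prop))

theorem isInvertible_fderiv_gradField {g h : ℝ → ℝ} (hg : ContDiff ℝ 1 g)
    (hgh : ∀ x, HasDerivAt g (h x) x) (hh : ∀ x, 0 < h x) {a₁ b₁ a₂ b₂ c₁ c₂ : ℝ}
    (ha₁ : 0 < a₁) (hb₁ : 0 < b₁) (ha₂ : 0 < a₂) (hb₂ : 0 < b₂) (hc₁ : 0 < c₁) (hc₂ : 0 < c₂)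
    (p q : ℝ × ℝ) {x : ℝ × (ℝ × ℝ)} (hx : x.1 ≠ 0) :
    (fderiv ℝ (gradField g a₁ b₁ a₂ b₂ c₁ c₂ p q) x ∘L
      .inr ℝ ℝ (ℝ × ℝ)).IsInvertible := by
  set A := fderiv ℝ (gradField g a₁ b₁ a₂ b₂ c₁ c₂ p q) x ∘L .inr ℝ ℝ (ℝ × ℝ) with hAdef
  have happly (v : ℝ × ℝ) : A v = gradRate h a₁ b₁ a₂ b₂ c₁ c₂ p q x.1 0 x.2 v := by
    have hw : HasDerivAt (fun t : ℝ => x.2 + t • v) v 0 := by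
      simpa using ((hasDerivAt_id (0 : ℝ)).smul_const v).const_add x.2
    have he : HasDerivAt (fun _ : ℝ => x.1) 0 0 := hasDerivAt_const _ _
    have h1 := hasDerivAt_gradField hgh a₁ b₁ a₂ b₂ c₁ c₂ p q he hw hx
    have hf : HasFDerivAt (gradField g a₁ b₁ a₂ b₂ c₁ c₂ p q)
        (fderiv ℝ (gradField g a₁ b₁ a₂ b₂ c₁ c₂ p q) x)
        ((fun t : ℝ => (x.1, x.2 + t • v)) 0) := by
      simpa using ((contDiffAt_gradField hg a₁ b₁ a₂ b₂ c₁ c₂ p q hx).differentiableAt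
        one_ne_zero).hasFDerivAt
    have h2 := hf.comp_hasDerivAt 0 (he.prodMk hw)
    simpa [hAdef] using h2.unique h1
  have hinj : Function.Injective A := by
    refine (injective_iff_map_eq_zero A).2 fun v hv => ?_
    have hen := hessian_energy_le hh hc₁ hc₂ ((happly v).symm.trans hv)
    have hH₁ : 0 < b₁ * h x.2.1 + a₁ * h (-x.2.1) := 
      add_pos (mul_pos hb₁ (hh _)) (mul_pos ha₁ (hh _))
    have hH₂ : 0 < b₂ * h x.2.2 + a₂ * h (-x.2.2) := 
      add_pos (mul_pos hb₂ (hh _)) (mul_pos ha₂ (hh _))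
    have hv1 : v.1 ^ 2 = 0 := by nlinarith [sq_nonneg v.1, sq_nonneg v.2]
    have hv2 : v.2 ^ 2 = 0 := by nlinarith [sq_nonneg v.1, sq_nonneg v.2]
    exact Prod.ext (pow_eq_zero_iff two_ne_zero |>.1 hv1) (pow_eq_zero_iff two_ne_zero |>.1 hv2)
  exact ⟨(LinearEquiv.ofInjectiveEndo (A : (ℝ × ℝ) →ₗ[ℝ] (ℝ × ℝ)) hinj).toContinuousLinearEquiv,
    ContinuousLinearMap.ext fun v => rfl⟩

/-- The unperturbed coordinate-decoupled objective. -/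
def baseLoss (ℓ : ℝ → ℝ) (a₁ b₁ a₂ b₂ : ℝ) (w : ℝ × ℝ) : ℝ :=
  a₁ * ℓ (-w.1) + b₁ * ℓ w.1 + a₂ * ℓ (-w.2) + b₂ * ℓ w.2

/-- The rescaled loss of a single example `p`, with its hinge limit at `ε = 0`. -/
noncomputable def ridgeLoss (ℓ : ℝ → ℝ) (p : ℝ × ℝ) (ε : ℝ) (w : ℝ × ℝ) : ℝ :=
  if ε = 0 then max (-(dot w p)) 0 else ε ^ 2 * ℓ (-(dot w p) / ε ^ 2)

/-- The objective perturbed by two rescaled examples `p` and `q`. -/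
noncomputable def perturbedLoss (ℓ : ℝ → ℝ) (a₁ b₁ a₂ b₂ c₁ c₂ : ℝ) (p q : ℝ × ℝ) (ε : ℝ)
    (w : ℝ × ℝ) : ℝ :=
  baseLoss ℓ a₁ b₁ a₂ b₂ w + c₁ * ridgeLoss ℓ p ε w + c₂ * ridgeLoss ℓ q ε w

namespace AssumptionA

variable {ℓ : ℝ → ℝ} (hA : AssumptionA ℓ)
include hA

theorem continuous : Continuous ℓ := hA.smooth.continuous

theorem ridgeLoss_nonneg (p : ℝ × ℝ) (ε : ℝ) (w : ℝ × ℝ) : 0 ≤ ridgeLoss ℓ p ε w := by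
  unfold ridgeLoss
  split_ifs
  · exact le_max_right _ _
  · exact mul_nonneg (sq_nonneg _) (hA.nonneg _)

theorem ridgeLoss_le {p w : ℝ × ℝ} (h : 0 ≤ dot w p) (ε : ℝ) :
    ridgeLoss ℓ p ε w ≤ ε ^ 2 * ℓ 0 := by
  unfold ridgeLoss
  split_ifs with h0
  · simp [h0, h]
  · exact mul_le_mul_of_nonneg_left
      (hA.monotone (div_nonpos_of_nonpos_of_nonneg (by linarith) (sq_nonneg _))) (sq_nonneg _)

theorem continuous_ridgeLoss (p : ℝ × ℝ) (ε : ℝ) : Continuous (ridgeLoss ℓ p ε) := by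
  have hd := continuous_dot_left p
  have hc := hA.continuous
  unfold ridgeLoss
  split_ifs <;> fun_prop

theorem convexOn_ridgeLoss (p : ℝ × ℝ) (ε : ℝ) :
    ConvexOn ℝ Set.univ (ridgeLoss ℓ p ε) := by
  have hlin : IsLinearMap ℝ fun w => dot w p :=
    ⟨fun v w => dot_add_left v w p, fun a v => dot_smul_left a v p⟩
  have hneg : ConvexOn ℝ Set.univ fun w => -(dot w p) :=
    ((-hlin.mk').convexOn convex_univ)
  unfold ridgeLoss
  split_ifs with h0
  · exact hneg.sup (convexOn_const 0 convex_univ)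
  · have h : ConvexOn ℝ Set.univ fun w => ℓ (-(dot w p) / ε ^ 2) :=
      (hA.strictConvex.convexOn.comp_linearMap ((ε ^ 2)⁻¹ • (-hlin.mk'))).congr fun w _ => by
        simp [div_eq_inv_mul]
    exact h.smul (sq_nonneg ε)

section

variable {a₁ b₁ a₂ b₂ c₁ c₂ : ℝ}

theorem continuous_baseLoss : Continuous (baseLoss ℓ a₁ b₁ a₂ b₂) := by
  have hc := hA.continuous
  unfold baseLoss
  fun_prop

theorem continuous_perturbedLoss (p q : ℝ × ℝ) (ε : ℝ) :
    Continuous (perturbedLoss ℓ a₁ b₁ a₂ b₂ c₁ c₂ p q ε) :=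
  (hA.continuous_baseLoss.add (continuous_const.mul (hA.continuous_ridgeLoss p ε))).add
    (continuous_const.mul (hA.continuous_ridgeLoss q ε))

theorem hasDerivAt_ridgeLoss {p : ℝ × ℝ} {ε : ℝ} (hε : ε ≠ 0) (w v : ℝ × ℝ) :
    HasDerivAt (fun t : ℝ => ridgeLoss ℓ p ε (w + t • v))
      (-(dot v p) * deriv ℓ (-(dot w p) / ε ^ 2)) 0 := by
  have h1 : HasDerivAt (fun t : ℝ => -(dot (w + t • v) p) / ε ^ 2) (-(dot v p) / ε ^ 2) 0 := by
    simp only [dot_add_left, dot_smul_left]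
    simpa using ((((hasDerivAt_id (0 : ℝ)).mul_const (dot v p)).const_add (dot w p)).neg).div_const
      (ε ^ 2)
  have h2 := (((hA.hasDerivAt _).comp 0 h1).const_mul (ε ^ 2))
  simp only [ridgeLoss, hε, if_false]
  refine h2.congr_deriv ?_
  simp only [zero_smul, add_zero]
  field_simp

theorem hasDerivAt_perturbedLoss {p q : ℝ × ℝ} {ε : ℝ} (hε : ε ≠ 0) (w v : ℝ × ℝ) :
    HasDerivAt (fun t : ℝ => perturbedLoss ℓ a₁ b₁ a₂ b₂ c₁ c₂ p q ε (w + t • v))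
      (dot (gradField (deriv ℓ) a₁ b₁ a₂ b₂ c₁ c₂ p q (ε, w)) v) 0 := by
  have hcoord (a b x y : ℝ) : HasDerivAt (fun t : ℝ => a * ℓ (-(x + t * y)) + b * ℓ (x + t * y))
      ((b * deriv ℓ x - a * deriv ℓ (-x)) * y) 0 := by
    have h0 : HasDerivAt (fun t : ℝ => x + t * y) y 0 := by
      simpa using ((hasDerivAt_id (0 : ℝ)).mul_const y).const_add x
    have h1 := ((hA.hasDerivAt _).comp 0 h0.neg).const_mul a
    have h2 := ((hA.hasDerivAt _).comp 0 h0).const_mul b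
    refine (h1.add h2).congr_deriv ?_
    simp only [Pi.neg_apply, zero_mul, add_zero]
    ring
  have h := (((hcoord a₁ b₁ w.1 v.1).add (hcoord a₂ b₂ w.2 v.2)).add
    ((hA.hasDerivAt_ridgeLoss (p := p) hε w v).const_mul c₁)).add
    ((hA.hasDerivAt_ridgeLoss (p := q) hε w v).const_mul c₂)
  refine (h.congr_deriv ?_).congr_of_eventuallyEq (Eventually.of_forall fun t => ?_)
  · simp only [gradField, dot]
    ring
  · simp only [perturbedLoss, baseLoss, Prod.fst_add, Prod.snd_add, Prod.smul_fst, Prod.smul_snd,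
      smul_eq_mul, Pi.add_apply]
    ring

theorem gradField_eq_zero_of_isMin {p q : ℝ × ℝ} {ε : ℝ} (hε : ε ≠ 0) {w : ℝ × ℝ}
    (hw : ∀ v, perturbedLoss ℓ a₁ b₁ a₂ b₂ c₁ c₂ p q ε w ≤
      perturbedLoss ℓ a₁ b₁ a₂ b₂ c₁ c₂ p q ε v) :
    gradField (deriv ℓ) a₁ b₁ a₂ b₂ c₁ c₂ p q (ε, w) = 0 := by
  have hdot (v : ℝ × ℝ) : dot (gradField (deriv ℓ) a₁ b₁ a₂ b₂ c₁ c₂ p q (ε, w)) v = 0 := by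
    refine IsLocalMin.hasDerivAt_eq_zero (Eventually.of_forall fun t => ?_)
      (hA.hasDerivAt_perturbedLoss hε w v)
    simpa using hw _
  have h1 := hdot (1, 0)
  have h2 := hdot (0, 1)
  simp only [dot, mul_one, mul_zero, add_zero, zero_add] at h1 h2
  exact Prod.ext h1 h2

variable (ha₁ : 0 < a₁) (hb₁ : 0 < b₁) (ha₂ : 0 < a₂) (hb₂ : 0 < b₂)
include ha₁ hb₁ ha₂ hb₂

theorem strictConvexOn_baseLoss : StrictConvexOn ℝ Set.univ (baseLoss ℓ a₁ b₁ a₂ b₂) := by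
  refine ⟨convex_univ, fun v _ w _ hvw s t hs ht hst => ?_⟩
  have hle {a : ℝ} (ha : 0 < a) (x y : ℝ) :
      a * ℓ (s * x + t * y) ≤ a * (s * ℓ x + t * ℓ y) :=
    mul_le_mul_of_nonneg_left
      (hA.strictConvex.convexOn.2 (Set.mem_univ x) (Set.mem_univ y) hs.le ht.le hst) ha.le
  have hlt {a : ℝ} (ha : 0 < a) {x y : ℝ} (hxy : x ≠ y) :
      a * ℓ (s * x + t * y) < a * (s * ℓ x + t * ℓ y) :=
    mul_lt_mul_of_pos_left
      (hA.strictConvex.2 (Set.mem_univ x) (Set.mem_univ y) hxy hs ht hst) ha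
  have hneg (x y : ℝ) : -(s * x + t * y) = s * -x + t * -y := by ring
  have h1 := hle ha₁ (-v.1) (-w.1)
  have h2 := hle ha₂ (-v.2) (-w.2)
  simp only [baseLoss, Prod.fst_add, Prod.snd_add, Prod.smul_fst, Prod.smul_snd, smul_eq_mul, hneg]
  by_cases hf : v.1 = w.1
  · have hs' : v.2 ≠ w.2 := fun h => hvw (Prod.ext hf h)
    linarith [hle hb₁ v.1 w.1, hlt hb₂ hs']
  · linarith [hlt hb₁ hf, hle hb₂ v.2 w.2]

theorem eq_of_baseLoss_eq {w₀ w : ℝ × ℝ}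
    (hw₀ : ∀ v, baseLoss ℓ a₁ b₁ a₂ b₂ w₀ ≤ baseLoss ℓ a₁ b₁ a₂ b₂ v)
    (hw : baseLoss ℓ a₁ b₁ a₂ b₂ w = baseLoss ℓ a₁ b₁ a₂ b₂ w₀) : w = w₀ :=
  (hA.strictConvexOn_baseLoss ha₁ hb₁ ha₂ hb₂).eq_of_isMinOn
    (fun v _ => hw.trans_le (hw₀ v)) (fun v _ => hw₀ v) trivial trivial

theorem tendsto_baseLoss_cocompact :
    Tendsto (baseLoss ℓ a₁ b₁ a₂ b₂) (cocompact (ℝ × ℝ)) atTop := by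
  obtain ⟨C, hC, hlow⟩ := hA.exists_linear_lower_bound
  set m := min (min a₁ b₁) (min a₂ b₂) with hm
  have hm0 : 0 < m := lt_min (lt_min ha₁ hb₁) (lt_min ha₂ hb₂)
  have hma₁ : m ≤ a₁ := (min_le_left _ _).trans (min_le_left _ _)
  have hmb₁ : m ≤ b₁ := (min_le_left _ _).trans (min_le_right _ _)
  have hma₂ : m ≤ a₂ := (min_le_right _ _).trans (min_le_left _ _)
  have hmb₂ : m ≤ b₂ := (min_le_right _ _).trans (min_le_right _ _)
  have hcoord {a b : ℝ} (ha : m ≤ a) (hb : m ≤ b) (x : ℝ) :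
      m * ((|x| - C) / 2) ≤ a * ℓ (-x) + b * ℓ x := by
    have h1 := mul_le_mul_of_nonneg_right ha (hA.nonneg (-x))
    have h2 := mul_le_mul_of_nonneg_right hb (hA.nonneg x)
    have h3 := mul_nonneg hm0.le (hA.nonneg (-x))
    have h4 := mul_nonneg hm0.le (hA.nonneg x)
    rcases abs_cases x with ⟨h, _⟩ | ⟨h, _⟩ <;> rw [h]
    · linarith [mul_le_mul_of_nonneg_left (hlow x) hm0.le]
    · linarith [mul_le_mul_of_nonneg_left (hlow (-x)) hm0.le]
  have hnorm : Tendsto (fun w : ℝ × ℝ => m / 2 * ‖w‖ - m * C) (cocompact (ℝ × ℝ)) atTop :=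
    tendsto_atTop_add_const_right _ _
      (tendsto_norm_cocompact_atTop.const_mul_atTop (half_pos hm0))
  refine tendsto_atTop_mono (fun w => ?_) hnorm
  have hw : ‖w‖ ≤ |w.1| + |w.2| := by
    rw [Prod.norm_def]
    exact max_le (le_add_of_nonneg_right (abs_nonneg _)) (le_add_of_nonneg_left (abs_nonneg _))
  have h1 := hcoord hma₁ hmb₁ w.1
  have h2 := hcoord hma₂ hmb₂ w.2
  have h3 := mul_le_mul_of_nonneg_left hw (half_pos hm0).le
  unfold baseLoss
  linarith

variable (hc₁ : 0 < c₁) (hc₂ : 0 < c₂) (p q : ℝ × ℝ)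
include hc₁ hc₂

omit ha₁ hb₁ ha₂ hb₂ in
theorem baseLoss_le_perturbedLoss (ε : ℝ) (w : ℝ × ℝ) :
    baseLoss ℓ a₁ b₁ a₂ b₂ w ≤ perturbedLoss ℓ a₁ b₁ a₂ b₂ c₁ c₂ p q ε w := by
  have h1 := mul_nonneg hc₁.le (hA.ridgeLoss_nonneg p ε w)
  have h2 := mul_nonneg hc₂.le (hA.ridgeLoss_nonneg q ε w)
  unfold perturbedLoss
  linarith

theorem strictConvexOn_perturbedLoss (ε : ℝ) :
    StrictConvexOn ℝ Set.univ (perturbedLoss ℓ a₁ b₁ a₂ b₂ c₁ c₂ p q ε) :=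
  ((hA.strictConvexOn_baseLoss ha₁ hb₁ ha₂ hb₂).add_convexOn
    ((hA.convexOn_ridgeLoss p ε).smul hc₁.le)).add_convexOn ((hA.convexOn_ridgeLoss q ε).smul hc₂.le)

theorem exists_isMin_perturbedLoss (ε : ℝ) :
    ∃ w, ∀ v, perturbedLoss ℓ a₁ b₁ a₂ b₂ c₁ c₂ p q ε w ≤
      perturbedLoss ℓ a₁ b₁ a₂ b₂ c₁ c₂ p q ε v :=
  (hA.continuous_perturbedLoss p q ε).exists_forall_le
    (tendsto_atTop_mono (hA.baseLoss_le_perturbedLoss hc₁ hc₂ p q ε)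
      (hA.tendsto_baseLoss_cocompact ha₁ hb₁ ha₂ hb₂))

omit ha₁ hb₁ ha₂ hb₂ hc₁ hc₂ in
theorem add_deriv_mul_le_ridgeLoss {ε : ℝ} (hε : ε ≠ 0) (w v : ℝ × ℝ) :
    ridgeLoss ℓ p ε w - (dot v p - dot w p) * deriv ℓ (-(dot w p) / ε ^ 2) ≤ ridgeLoss ℓ p ε v := by
  simp only [ridgeLoss, hε, if_false]
  have h := mul_le_mul_of_nonneg_left
    (hA.add_deriv_mul_le (-(dot w p) / ε ^ 2) (-(dot v p) / ε ^ 2)) (sq_nonneg ε)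
  refine le_trans (le_of_eq ?_) h
  field_simp
  ring

theorem isMin_of_gradField_eq_zero {ε : ℝ} (hε : ε ≠ 0) {w : ℝ × ℝ}
    (hw : gradField (deriv ℓ) a₁ b₁ a₂ b₂ c₁ c₂ p q (ε, w) = 0) (v : ℝ × ℝ) :
    perturbedLoss ℓ a₁ b₁ a₂ b₂ c₁ c₂ p q ε w ≤ perturbedLoss ℓ a₁ b₁ a₂ b₂ c₁ c₂ p q ε v := by
  have h1 := congrArg Prod.fst hw
  have h2 := congrArg Prod.snd hw
  simp only [gradField, Prod.fst_zero, Prod.snd_zero] at h1 h2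
  have e1 := mul_le_mul_of_nonneg_left (hA.add_deriv_mul_le_ridgeLoss p hε w v) hc₁.le
  have e2 := mul_le_mul_of_nonneg_left (hA.add_deriv_mul_le_ridgeLoss q hε w v) hc₂.le
  have e3 := mul_le_mul_of_nonneg_left (hA.add_deriv_mul_le w.1 v.1) hb₁.le
  have e4 := mul_le_mul_of_nonneg_left (hA.add_deriv_mul_le (-w.1) (-v.1)) ha₁.le
  have e5 := mul_le_mul_of_nonneg_left (hA.add_deriv_mul_le w.2 v.2) hb₂.le
  have e6 := mul_le_mul_of_nonneg_left (hA.add_deriv_mul_le (-w.2) (-v.2)) ha₂.le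
  have hdp : dot v p - dot w p = (v.1 - w.1) * p.1 + (v.2 - w.2) * p.2 := by unfold dot; ring
  have hdq : dot v q - dot w q = (v.1 - w.1) * q.1 + (v.2 - w.2) * q.2 := by unfold dot; ring
  rw [hdp] at e1
  rw [hdq] at e2
  simp only [perturbedLoss, baseLoss]
  linear_combination e1 + e2 + e3 + e4 + e5 + e6 - (v.1 - w.1) * h1 - (v.2 - w.2) * h2

end

end AssumptionA

theorem tendsto_zero_of_tendsto_sq {ι : Type*} {l : Filter ι} {f : ι → ℝ}
    (hf : Tendsto (fun i => f i ^ 2) l (𝓝 0)) : Tendsto f l (𝓝 0) := by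
  have h := (Real.continuous_sqrt.tendsto 0).comp hf
  rw [Real.sqrt_zero] at h
  refine tendsto_zero_iff_abs_tendsto_zero _ |>.2 (h.congr fun i => ?_)
  exact Real.sqrt_sq_eq_abs (f i)

/-- If the two ridge directions are antiparallel, the derivative of the minimizer is determined
by its component along the ridge, and that component is controlled by the ridge argument. -/
theorem antiparallel_rate_eq {h : ℝ → ℝ} (hh : ∀ x, 0 < h x) {a₁ b₁ a₂ b₂ c₁ c₂ : ℝ}
    (ha₁ : 0 < a₁) (hb₁ : 0 < b₁) (ha₂ : 0 < a₂) (hb₂ : 0 < b₂)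
    (hc₁ : 0 < c₁) (hc₂ : 0 < c₂) {p : ℝ × ℝ} {r e : ℝ} (he : e ≠ 0) {w w' : ℝ × ℝ}
    (hrate : gradRate h a₁ b₁ a₂ b₂ c₁ c₂ p (r • p) e 1 w w' = 0) :
    |dot w' p| ≤ 2 * (|-(dot w p) / e ^ 2| * |e|) ∧
    w'.1 * (p.1 ^ 2 * (b₂ * h w.2 + a₂ * h (-w.2)) + p.2 ^ 2 * (b₁ * h w.1 + a₁ * h (-w.1))) =
      p.1 * (b₂ * h w.2 + a₂ * h (-w.2)) * dot w' p ∧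
    w'.2 * (p.1 ^ 2 * (b₂ * h w.2 + a₂ * h (-w.2)) + p.2 ^ 2 * (b₁ * h w.1 + a₁ * h (-w.1))) =
      p.2 * (b₁ * h w.1 + a₁ * h (-w.1)) * dot w' p := by
  have h1 := congrArg Prod.fst hrate
  have h2 := congrArg Prod.snd hrate
  have hH₁ : 0 < b₁ * h w.1 + a₁ * h (-w.1) := add_pos (mul_pos hb₁ (hh _)) (mul_pos ha₁ (hh _))
  have hH₂ : 0 < b₂ * h w.2 + a₂ * h (-w.2) := add_pos (mul_pos hb₂ (hh _)) (mul_pos ha₂ (hh _))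
  simp only [gradRate, Prod.fst_zero, Prod.snd_zero, Prod.smul_fst, Prod.smul_snd,
    smul_eq_mul] at h1 h2
  set H₁ := b₁ * h w.1 + a₁ * h (-w.1)
  set H₂ := b₂ * h w.2 + a₂ * h (-w.2)
  have hx : dot w' p = w'.1 * p.1 + w'.2 * p.2 := rfl
  have hdot (v : ℝ × ℝ) : dot v (r • p) = r * dot v p := by
    simp only [dot, Prod.smul_fst, Prod.smul_snd, smul_eq_mul]; ring
  set k := c₁ * h (-(dot w p) / e ^ 2) + c₂ * r ^ 2 * h (-(dot w (r • p)) / e ^ 2) with hk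
  have hk0 : 0 < k := add_pos_of_pos_of_nonneg (mul_pos hc₁ (hh _))
    (mul_nonneg (mul_nonneg hc₂.le (sq_nonneg r)) (hh _).le)
  set u := -(dot w p) / e ^ 2 with hu
  have hK : c₁ * ridgeRate h e 1 w w' p + c₂ * r * ridgeRate h e 1 w w' (r • p) =
      k * ((dot w' p + 2 * (u * e)) / e ^ 2) := by
    rw [hk, hu, ridgeRate, ridgeRate, hdot w']
    conv_lhs => rw [show dot w (r • p) / e ^ 2 = r * (dot w p / e ^ 2) by rw [hdot]; ring]
    field_simp
    ring
  have h1' : H₁ * w'.1 + p.1 * (k * ((dot w' p + 2 * (u * e)) / e ^ 2)) = 0 := by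
    rw [← hK]; linear_combination h1
  have h2' : H₂ * w'.2 + p.2 * (k * ((dot w' p + 2 * (u * e)) / e ^ 2)) = 0 := by
    rw [← hK]; linear_combination h2
  refine ⟨?_, ?_, ?_⟩
  · have hprod : dot w' p * (dot w' p + 2 * (u * e)) * (k / e ^ 2) ≤ 0 := by
      have := mul_nonneg hH₁.le (sq_nonneg w'.1)
      have := mul_nonneg hH₂.le (sq_nonneg w'.2)
      have : dot w' p * (dot w' p + 2 * (u * e)) * (k / e ^ 2)
          = -(H₁ * w'.1 ^ 2 + H₂ * w'.2 ^ 2) := by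
        have hs : dot w' p * (k * ((dot w' p + 2 * (u * e)) / e ^ 2))
            = -(H₁ * w'.1 ^ 2 + H₂ * w'.2 ^ 2) := by
          rw [hx] at *
          linear_combination w'.1 * h1' + w'.2 * h2'
        rw [← hs]; ring
      linarith
    have hpos : 0 < k / e ^ 2 := div_pos hk0 (by positivity)
    have hle : dot w' p ^ 2 ≤ -(2 * (u * e)) * dot w' p := by
      nlinarith [nonpos_of_mul_nonpos_left hprod hpos]
    rw [← abs_mul]
    by_contra! hlt
    have habs : -(2 * (u * e)) * dot w' p ≤ 2 * |u * e| * |dot w' p| := by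
      refine (le_abs_self _).trans (le_of_eq ?_)
      rw [abs_mul, abs_neg, abs_mul, abs_two]
    have hxpos : 0 < |dot w' p| := lt_of_le_of_lt (by positivity) hlt
    nlinarith [sq_abs (dot w' p)]
  · rw [hx] at *
    linear_combination p.2 ^ 2 * h1' - p.1 * p.2 * h2'
  · rw [hx] at *
    linear_combination p.1 ^ 2 * h2' - p.1 * p.2 * h1'

namespace AssumptionA

variable {ℓ : ℝ → ℝ} (hA : AssumptionA ℓ) {a₁ b₁ a₂ b₂ c₁ c₂ : ℝ}
  (ha₁ : 0 < a₁) (hb₁ : 0 < b₁) (ha₂ : 0 < a₂) (hb₂ : 0 < b₂) (hc₁ : 0 < c₁) (hc₂ : 0 < c₂)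
  {p q : ℝ × ℝ} {W : ℝ → ℝ × ℝ}
  (hW : ∀ ε v, perturbedLoss ℓ a₁ b₁ a₂ b₂ c₁ c₂ p q ε (W ε) ≤
    perturbedLoss ℓ a₁ b₁ a₂ b₂ c₁ c₂ p q ε v)
include hA ha₁ hb₁ ha₂ hb₂ hc₁ hc₂ hW

theorem contDiffAt_minimizer {ε : ℝ} (hε : ε ≠ 0) : ContDiffAt ℝ 1 W ε := by
  have hzero := hA.gradField_eq_zero_of_isMin hε (hW ε)
  have hcd : ContDiffAt ℝ 1 (gradField (deriv ℓ) a₁ b₁ a₂ b₂ c₁ c₂ p q) (ε, W ε) :=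
    contDiffAt_gradField hA.contDiff_deriv a₁ b₁ a₂ b₂ c₁ c₂ p q hε
  have hinv := isInvertible_fderiv_gradField (x := (ε, W ε)) hA.contDiff_deriv
    hA.hasDerivAt_deriv hA.secondDeriv_pos ha₁ hb₁ ha₂ hb₂ hc₁ hc₂ p q hε
  refine (hcd.contDiffAt_implicitFunction one_ne_zero hinv).congr_of_eventuallyEq ?_
  filter_upwards [hcd.eventually_apply_implicitFunction one_ne_zero hinv,
    isOpen_ne.mem_nhds hε] with x hx hx0
  rw [hzero] at hx
  exact (hA.strictConvexOn_perturbedLoss ha₁ hb₁ ha₂ hb₂ hc₁ hc₂ p q x).eq_of_isMinOn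
    (fun v _ => hW x v)
    (fun v _ => hA.isMin_of_gradField_eq_zero ha₁ hb₁ ha₂ hb₂ hc₁ hc₂ p q hx0 hx v)
    trivial trivial

theorem gradRate_minimizer_eq_zero {ε : ℝ} (hε : ε ≠ 0) :
    gradRate (deriv (deriv ℓ)) a₁ b₁ a₂ b₂ c₁ c₂ p q ε 1 (W ε) (deriv W ε) = 0 := by
  have hd := ((hA.contDiffAt_minimizer ha₁ hb₁ ha₂ hb₂ hc₁ hc₂ hW hε).differentiableAt
    one_ne_zero).hasDerivAt
  refine (hasDerivAt_gradField hA.hasDerivAt_deriv a₁ b₁ a₂ b₂ c₁ c₂ p q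
    (hasDerivAt_id ε) hd hε).unique ((hasDerivAt_const ε (0 : ℝ × ℝ)).congr_of_eventuallyEq ?_)
  filter_upwards [isOpen_ne.mem_nhds hε] with x hx
  exact hA.gradField_eq_zero_of_isMin hx (hW x)

variable {w₀ : ℝ × ℝ} (hw₀ : ∀ v, baseLoss ℓ a₁ b₁ a₂ b₂ w₀ ≤ baseLoss ℓ a₁ b₁ a₂ b₂ v)
include hw₀

section

variable (hp : 0 ≤ dot w₀ p) (hq : 0 ≤ dot w₀ q)
include hp hq

omit ha₁ hb₁ ha₂ hb₂ hw₀ in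
theorem baseLoss_minimizer_le (ε : ℝ) :
    baseLoss ℓ a₁ b₁ a₂ b₂ (W ε) ≤ baseLoss ℓ a₁ b₁ a₂ b₂ w₀ + ε ^ 2 * ((c₁ + c₂) * ℓ 0) := by
  have h1 := hA.baseLoss_le_perturbedLoss (a₁ := a₁) (b₁ := b₁) (a₂ := a₂) (b₂ := b₂)
    hc₁ hc₂ p q ε (W ε)
  have h2 := hW ε w₀
  have h3 := mul_le_mul_of_nonneg_left (hA.ridgeLoss_le hp ε) hc₁.le
  have h4 := mul_le_mul_of_nonneg_left (hA.ridgeLoss_le hq ε) hc₂.le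
  have h5 : perturbedLoss ℓ a₁ b₁ a₂ b₂ c₁ c₂ p q ε w₀ = baseLoss ℓ a₁ b₁ a₂ b₂ w₀
    + c₁ * ridgeLoss ℓ p ε w₀ + c₂ * ridgeLoss ℓ q ε w₀ := rfl
  linarith

theorem minimizer_zero : W 0 = w₀ := by
  refine hA.eq_of_baseLoss_eq ha₁ hb₁ ha₂ hb₂ hw₀ (le_antisymm ?_ (hw₀ _))
  simpa using hA.baseLoss_minimizer_le hc₁ hc₂ hW hp hq 0

theorem tendsto_minimizer : Tendsto W (𝓝 0) (𝓝 w₀) := by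
  refine tendsto_nhds_of_tendsto_isMin hA.continuous_baseLoss
    (hA.tendsto_baseLoss_cocompact ha₁ hb₁ ha₂ hb₂)
    (fun w hw => hA.eq_of_baseLoss_eq ha₁ hb₁ ha₂ hb₂ hw₀ hw) ?_
  have hup : Tendsto (fun ε : ℝ => baseLoss ℓ a₁ b₁ a₂ b₂ w₀ + ε ^ 2 * ((c₁ + c₂) * ℓ 0)) (𝓝 0)
      (𝓝 (baseLoss ℓ a₁ b₁ a₂ b₂ w₀)) := by
    have : Continuous fun ε : ℝ =>
      baseLoss ℓ a₁ b₁ a₂ b₂ w₀ + ε ^ 2 * ((c₁ + c₂) * ℓ 0) := by fun_prop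
    simpa using this.tendsto 0
  exact tendsto_of_tendsto_of_tendsto_of_le_of_le tendsto_const_nhds hup (fun ε => hw₀ _)
    (hA.baseLoss_minimizer_le hc₁ hc₂ hW hp hq)

end

variable (hlim : Tendsto W (𝓝[≠] 0) (𝓝 w₀))
include hlim

omit ha₁ hb₁ ha₂ hb₂ hc₁ hc₂ in
theorem tendsto_ridge_forces :
    Tendsto (fun ε => c₁ * p.1 * deriv ℓ (-(dot (W ε) p) / ε ^ 2)
      + c₂ * q.1 * deriv ℓ (-(dot (W ε) q) / ε ^ 2)) (𝓝[≠] 0) (𝓝 0) := by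
  have hz : gradField (deriv ℓ) a₁ b₁ a₂ b₂ 0 0 p q (1, w₀) = 0 :=
    hA.gradField_eq_zero_of_isMin one_ne_zero (by simpa [perturbedLoss] using hw₀)
  have hz1 := congrArg Prod.fst hz
  simp only [gradField, zero_mul, sub_zero, Prod.fst_zero] at hz1
  have hcont : Continuous fun w : ℝ × ℝ => b₁ * deriv ℓ w.1 - a₁ * deriv ℓ (-w.1) := by
    have := hA.contDiff_deriv.continuous
    fun_prop
  have h := (hcont.tendsto w₀).comp hlim
  rw [hz1] at h
  refine h.congr' ?_
  filter_upwards [self_mem_nhdsWithin] with ε hε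
  have h1 := congrArg Prod.fst (hA.gradField_eq_zero_of_isMin hε (hW ε))
  simp only [gradField, Prod.fst_zero] at h1
  simp only [Function.comp_apply]
  linarith

omit hw₀ in
theorem tendsto_deriv_minimizer_of_atBot
    (hp : Tendsto (fun ε => -(dot (W ε) p) / ε ^ 2) (𝓝[≠] 0) atBot)
    (hq : Tendsto (fun ε => -(dot (W ε) q) / ε ^ 2) (𝓝[≠] 0) atBot) :
    Tendsto (deriv W) (𝓝[≠] 0) (𝓝 0) := by
  have hR := (((hA.tendsto_secondDeriv_mul_sq.comp hp).const_mul c₁).add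
    ((hA.tendsto_secondDeriv_mul_sq.comp hq).const_mul c₂))
  simp only [mul_zero, add_zero, Function.comp_def] at hR
  have hh := hA.secondDeriv_pos
  have hc := hA.continuous_secondDeriv
  have hH₁ (x : ℝ) : 0 < b₁ * deriv (deriv ℓ) x + a₁ * deriv (deriv ℓ) (-x) :=
    add_pos (mul_pos hb₁ (hh _)) (mul_pos ha₁ (hh _))
  have hH₂ (x : ℝ) : 0 < b₂ * deriv (deriv ℓ) x + a₂ * deriv (deriv ℓ) (-x) :=
    add_pos (mul_pos hb₂ (hh _)) (mul_pos ha₂ (hh _))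
  have hen : ∀ᶠ ε in 𝓝[≠] (0 : ℝ), _ := eventually_mem_nhdsWithin.mono fun ε hε =>
    hessian_energy_le hh hc₁ hc₂ (hA.gradRate_minimizer_eq_zero ha₁ hb₁ ha₂ hb₂ hc₁ hc₂ hW hε)
  simp only [one_pow, one_mul] at hen
  have h1 : Continuous fun w : ℝ × ℝ => b₁ * deriv (deriv ℓ) w.1 + a₁ * deriv (deriv ℓ) (-w.1) := by
    fun_prop
  have h2 : Continuous fun w : ℝ × ℝ => b₂ * deriv (deriv ℓ) w.2 + a₂ * deriv (deriv ℓ) (-w.2) := by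
    fun_prop
  have hlim1 := hR.div ((h1.tendsto w₀).comp hlim) (hH₁ _).ne'
  have hlim2 := hR.div ((h2.tendsto w₀).comp hlim) (hH₂ _).ne'
  rw [zero_div] at hlim1 hlim2
  have hfst : Tendsto (fun ε => (deriv W ε).1) (𝓝[≠] 0) (𝓝 0) := by
    refine tendsto_zero_of_tendsto_sq
      (squeeze_zero' (Eventually.of_forall fun _ => sq_nonneg _) ?_ hlim1)
    filter_upwards [hen] with ε he
    refine (le_div_iff₀ (hH₁ (W ε).1)).2 ?_
    linarith [mul_nonneg (hH₂ (W ε).2).le (sq_nonneg (deriv W ε).2)]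
  have hsnd : Tendsto (fun ε => (deriv W ε).2) (𝓝[≠] 0) (𝓝 0) := by
    refine tendsto_zero_of_tendsto_sq
      (squeeze_zero' (Eventually.of_forall fun _ => sq_nonneg _) ?_ hlim2)
    filter_upwards [hen] with ε he
    refine (le_div_iff₀ (hH₂ (W ε).2)).2 ?_
    linarith [mul_nonneg (hH₁ (W ε).1).le (sq_nonneg (deriv W ε).1)]
  exact hfst.prodMk_nhds hsnd

theorem tendsto_deriv_minimizer_of_antiparallel (hp : 0 < p.1) {r : ℝ} (hr : r < 0)
    (hqp : q = r • p) : Tendsto (deriv W) (𝓝[≠] 0) (𝓝 0) := by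
  subst hqp
  set u : ℝ → ℝ := fun ε => -(dot (W ε) p) / ε ^ 2 with hu
  have hmono : StrictMono fun s => c₁ * deriv ℓ s + c₂ * r * deriv ℓ (r * s) := by
    intro s t hst
    have h1 := mul_lt_mul_of_pos_left (hA.strictMono_deriv hst) hc₁
    have h2 := mul_lt_mul_of_neg_left
      (hA.strictMono_deriv (mul_lt_mul_of_neg_left hst hr)) (mul_neg_of_pos_of_neg hc₂ hr)
    exact add_lt_add h1 h2
  have hforce : Tendsto (fun ε => c₁ * deriv ℓ (u ε) + c₂ * r * deriv ℓ (r * u ε))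
      (𝓝[≠] 0) (𝓝 0) := by
    have h := (hA.tendsto_ridge_forces hW hw₀ hlim).const_mul p.1⁻¹
    rw [mul_zero] at h
    refine h.congr fun ε => ?_
    have hd : -(dot (W ε) (r • p)) / ε ^ 2 = r * u ε := by
      simp only [hu, dot, Prod.smul_fst, Prod.smul_snd, smul_eq_mul]; ring
    rw [hd, show -(dot (W ε) p) / ε ^ 2 = u ε from rfl]
    simp only [Prod.smul_fst, smul_eq_mul]
    field_simp
  have htop : Tendsto (fun s => c₁ * deriv ℓ s + c₂ * r * deriv ℓ (r * s)) atTop (𝓝 c₁) := by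
    simpa using (hA.deriv_tendsto_one_atTop.const_mul c₁).add
      ((hA.deriv_tendsto_zero_atBot.comp
        (tendsto_id.const_mul_atTop_of_neg hr)).const_mul (c₂ * r))
  have hbot : Tendsto (fun s => c₁ * deriv ℓ s + c₂ * r * deriv ℓ (r * s)) atBot
      (𝓝 (c₂ * r)) := by
    simpa using (hA.deriv_tendsto_zero_atBot.const_mul c₁).add
      ((hA.deriv_tendsto_one_atTop.comp
        (tendsto_id.const_mul_atBot_of_neg hr)).const_mul (c₂ * r))
  obtain ⟨S, hS⟩ := (htop.eventually_const_lt hc₁).exists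
  obtain ⟨T, hT⟩ := (hbot.eventually_lt_const (mul_neg_of_pos_of_neg hc₂ hr)).exists
  have hbound : ∀ᶠ ε in 𝓝[≠] (0 : ℝ), |u ε| ≤ max |T| |S| := by
    filter_upwards [hforce.eventually_lt_const hS, hforce.eventually_const_lt hT] with ε h1 h2
    exact abs_le_max_abs_abs (hmono.lt_iff_lt.1 h2).le (hmono.lt_iff_lt.1 h1).le
  have hh := hA.secondDeriv_pos
  have hc := hA.continuous_secondDeriv
  have hrate : ∀ᶠ ε in 𝓝[≠] (0 : ℝ), _ := eventually_mem_nhdsWithin.mono fun ε hε =>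
    antiparallel_rate_eq hh ha₁ hb₁ ha₂ hb₂ hc₁ hc₂ hε
      (hA.gradRate_minimizer_eq_zero ha₁ hb₁ ha₂ hb₂ hc₁ hc₂ hW hε)
  have hx : Tendsto (fun ε => dot (deriv W ε) p) (𝓝[≠] 0) (𝓝 0) := by
    have hε : Tendsto (fun ε : ℝ => 2 * (max |T| |S| * |ε|)) (𝓝[≠] 0) (𝓝 0) := by
      have : Continuous fun ε : ℝ => 2 * (max |T| |S| * |ε|) := by fun_prop
      simpa using (this.tendsto 0).mono_left nhdsWithin_le_nhds
    refine squeeze_zero_norm' ?_ hε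
    filter_upwards [hrate, hbound] with ε h1 h2
    exact h1.1.trans (mul_le_mul_of_nonneg_left
      (mul_le_mul_of_nonneg_right h2 (abs_nonneg ε)) zero_le_two)
  have h1 : Continuous fun w : ℝ × ℝ => b₁ * deriv (deriv ℓ) w.1 + a₁ * deriv (deriv ℓ) (-w.1) := by
    fun_prop
  have h2 : Continuous fun w : ℝ × ℝ => b₂ * deriv (deriv ℓ) w.2 + a₂ * deriv (deriv ℓ) (-w.2) := by
    fun_prop
  have hDpos (w : ℝ × ℝ) : 0 < p.1 ^ 2 * (b₂ * deriv (deriv ℓ) w.2 + a₂ * deriv (deriv ℓ) (-w.2))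
      + p.2 ^ 2 * (b₁ * deriv (deriv ℓ) w.1 + a₁ * deriv (deriv ℓ) (-w.1)) :=
    add_pos_of_pos_of_nonneg
      (mul_pos (pow_pos hp 2) (add_pos (mul_pos hb₂ (hh _)) (mul_pos ha₂ (hh _))))
      (mul_nonneg (sq_nonneg _) (add_pos (mul_pos hb₁ (hh _)) (mul_pos ha₁ (hh _))).le)
  have hD := (((h2.const_mul (p.1 ^ 2)).add (h1.const_mul (p.2 ^ 2))).tendsto w₀).comp hlim
  have hlim1 := ((((h2.const_mul p.1).tendsto w₀).comp hlim).mul hx).div hD (hDpos w₀).ne'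
  have hlim2 := ((((h1.const_mul p.2).tendsto w₀).comp hlim).mul hx).div hD (hDpos w₀).ne'
  rw [mul_zero, zero_div] at hlim1 hlim2
  refine Tendsto.prodMk_nhds (hlim1.congr' ?_) (hlim2.congr' ?_)
  · filter_upwards [hrate] with ε he
    exact (div_eq_iff (hDpos (W ε)).ne').2 he.2.1.symm
  · filter_upwards [hrate] with ε he
    exact (div_eq_iff (hDpos (W ε)).ne').2 he.2.2.symm

end AssumptionA

namespace AssumptionA

variable {ℓ : ℝ → ℝ} (hA : AssumptionA ℓ) {a₁ b₁ a₂ b₂ c₁ c₂ : ℝ}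
  (ha₁ : 0 < a₁) (hb₁ : 0 < b₁) (ha₂ : 0 < a₂) (hb₂ : 0 < b₂) (hc₁ : 0 < c₁) (hc₂ : 0 < c₂)
  {p q : ℝ × ℝ} {W : ℝ → ℝ × ℝ}
  (hW : ∀ ε v, perturbedLoss ℓ a₁ b₁ a₂ b₂ c₁ c₂ p q ε (W ε) ≤
    perturbedLoss ℓ a₁ b₁ a₂ b₂ c₁ c₂ p q ε v)
  {w₀ : ℝ × ℝ} (hw₀ : ∀ v, baseLoss ℓ a₁ b₁ a₂ b₂ w₀ ≤ baseLoss ℓ a₁ b₁ a₂ b₂ v)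
  (hlim : Tendsto W (𝓝[≠] 0) (𝓝 w₀)) (hp : 0 < p.1)
include hA ha₁ hb₁ ha₂ hb₂ hc₁ hc₂ hW hw₀ hlim hp

theorem tendsto_deriv_minimizer_of_dot_pos (hq : 0 < dot w₀ q) :
    Tendsto (deriv W) (𝓝[≠] 0) (𝓝 0) := by
  have hinv : Tendsto (fun ε : ℝ => (ε ^ 2)⁻¹) (𝓝[≠] 0) atTop := by
    refine tendsto_inv_nhdsGT_zero.comp (tendsto_nhdsWithin_iff.2 ⟨?_, ?_⟩)
    · simpa using ((continuous_pow 2).tendsto (0 : ℝ)).mono_left nhdsWithin_le_nhds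
    · filter_upwards [self_mem_nhdsWithin] with ε hε
      exact sq_pos_of_ne_zero hε
  have hv : Tendsto (fun ε => -(dot (W ε) q) / ε ^ 2) (𝓝[≠] 0) atBot :=
    (((continuous_dot_left q).tendsto w₀).comp hlim).neg.neg_mul_atTop (neg_lt_zero.2 hq) hinv
  have hgv := hA.deriv_tendsto_zero_atBot.comp hv
  refine hA.tendsto_deriv_minimizer_of_atBot ha₁ hb₁ ha₂ hb₂ hc₁ hc₂ hW hlim
    (hA.tendsto_atBot_of_tendsto_deriv ?_) hv
  have h := ((hA.tendsto_ridge_forces hW hw₀ hlim).sub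
    (hgv.const_mul (c₂ * q.1))).const_mul (c₁ * p.1)⁻¹
  simp only [mul_zero, sub_zero] at h
  refine h.congr fun ε => ?_
  simp only [Function.comp_apply, add_sub_cancel_right]
  exact inv_mul_cancel_left₀ (mul_pos hc₁ hp).ne' _

theorem tendsto_deriv_minimizer_of_parallel {r : ℝ} (hr : 0 < r) (hqp : q = r • p) :
    Tendsto (deriv W) (𝓝[≠] 0) (𝓝 0) := by
  subst hqp
  have hu : Tendsto (fun ε => -(dot (W ε) p) / ε ^ 2) (𝓝[≠] 0) atBot := by
    refine hA.tendsto_atBot_of_tendsto_deriv ?_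
    have h := (hA.tendsto_ridge_forces hW hw₀ hlim).const_mul (c₁ * p.1)⁻¹
    rw [mul_zero] at h
    refine squeeze_zero (fun ε => (hA.deriv_pos _).le) (fun ε => ?_) h
    have hcp := mul_pos hc₁ hp
    rw [inv_mul_eq_div, le_div_iff₀ hcp]
    have : 0 ≤ c₂ * (r • p).1 * deriv ℓ (-(dot (W ε) (r • p)) / ε ^ 2) :=
      mul_nonneg (mul_nonneg hc₂.le (mul_pos hr hp).le) (hA.deriv_pos _).le
    linarith
  refine hA.tendsto_deriv_minimizer_of_atBot ha₁ hb₁ ha₂ hb₂ hc₁ hc₂ hW hlim hu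
    ((hu.const_mul_atBot hr).congr fun ε => ?_)
  simp only [dot, Prod.smul_fst, Prod.smul_snd, smul_eq_mul]
  ring

end AssumptionA

/-- (Continuity and differentiability of the perturbed minimizer, 2-d.)
For the coordinate-decoupled objective `L` with minimizer `w* = (w₁*, w₂*)`,
`w₁* > w₂* > 0`, `p = (w₂*, -w₁*)`, a nonzero `q` with `qᵀw* ≥ 0`, `c₁, c₂ > 0`, and
`L_ε = L + c₁ ℓ_{1,ε} + c₂ ℓ_{2,ε}`: the perturbed objective is strictly convex for
every `ε`, and its unique minimizer `w*_ε` is continuous in `ε` on all of `ℝ`,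
continuously differentiable at every `ε ≠ 0`, and continuously differentiable on a
neighborhood of `ε = 0` (with `w*_0 = w*`). -/
theorem perturbed_minimizer_two_dim
    (ℓ : ℝ → ℝ) (hA : AssumptionA ℓ)
    (m₁ n₁ m₂ n₂ : ℕ) (hm₁ : 0 < m₁) (hn₁ : 0 < n₁) (hm₂ : 0 < m₂) (hn₂ : 0 < n₂)
    (L : ℝ × ℝ → ℝ)
    (hL : ∀ w : ℝ × ℝ, L w =
      (m₁ : ℝ) * ℓ (-w.1) + (n₁ : ℝ) * ℓ w.1 + (m₂ : ℝ) * ℓ (-w.2) + (n₂ : ℝ) * ℓ w.2)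
    (wstar : ℝ × ℝ) (hmin : ∀ w, L wstar ≤ L w)
    (hpos : 0 < wstar.2) (hord : wstar.2 < wstar.1)
    (p q : ℝ × ℝ) (hp : p = (wstar.2, -wstar.1)) (hq : q ≠ 0) (hqw : 0 ≤ dot q wstar)
    (c₁ c₂ : ℝ) (hc₁ : 0 < c₁) (hc₂ : 0 < c₂)
    (ℓ1 ℓ2 : ℝ → ℝ × ℝ → ℝ)
    (hℓ1 : ∀ ε w, ℓ1 ε w =
      if ε = 0 then max (-(dot w p)) 0 else ε ^ 2 * ℓ (-(dot w p) / ε ^ 2))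
    (hℓ2 : ∀ ε w, ℓ2 ε w =
      if ε = 0 then max (-(dot w q)) 0 else ε ^ 2 * ℓ (-(dot w q) / ε ^ 2))
    (Leps : ℝ → ℝ × ℝ → ℝ)
    (hLeps : ∀ ε w, Leps ε w = L w + c₁ * ℓ1 ε w + c₂ * ℓ2 ε w) :
    (∀ ε, StrictConvexOn ℝ Set.univ (Leps ε)) ∧
    ∃ wstareps : ℝ → ℝ × ℝ,
      (∀ ε w, Leps ε (wstareps ε) ≤ Leps ε w) ∧
      wstareps 0 = wstar ∧
      Continuous wstareps ∧
      (∀ ε : ℝ, ε ≠ 0 → ContDiffAt ℝ 1 wstareps ε) ∧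
      ∃ U ∈ 𝓝 (0 : ℝ), ContDiffOn ℝ 1 wstareps U := by
  have ha₁ : (0 : ℝ) < m₁ := Nat.cast_pos.2 hm₁
  have hb₁ : (0 : ℝ) < n₁ := Nat.cast_pos.2 hn₁
  have ha₂ : (0 : ℝ) < m₂ := Nat.cast_pos.2 hm₂
  have hb₂ : (0 : ℝ) < n₂ := Nat.cast_pos.2 hn₂
  obtain rfl : L = baseLoss ℓ m₁ n₁ m₂ n₂ := funext hL
  obtain rfl : Leps = perturbedLoss ℓ m₁ n₁ m₂ n₂ c₁ c₂ p q :=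
    funext fun ε => funext fun w => by rw [hLeps, hℓ1, hℓ2]; rfl
  refine ⟨hA.strictConvexOn_perturbedLoss ha₁ hb₁ ha₂ hb₂ hc₁ hc₂ p q, ?_⟩
  choose W hW using hA.exists_isMin_perturbedLoss ha₁ hb₁ ha₂ hb₂ hc₁ hc₂ p q
  have hp1 : 0 < p.1 := by rw [hp]; exact hpos
  have hdp : 0 ≤ dot wstar p := by rw [hp]; simp only [dot]; linarith
  have hdq : 0 ≤ dot wstar q := by
    have hcomm : dot wstar q = dot q wstar := by simp only [dot]; ring
    rwa [hcomm]
  have hW0 : W 0 = wstar := hA.minimizer_zero ha₁ hb₁ ha₂ hb₂ hc₁ hc₂ hW hmin hdp hdq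
  have hW0lim : Tendsto W (𝓝 0) (𝓝 wstar) :=
    hA.tendsto_minimizer ha₁ hb₁ ha₂ hb₂ hc₁ hc₂ hW hmin hdp hdq
  have hlim := hW0lim.mono_left (nhdsWithin_le_nhds (s := {0}ᶜ))
  have hderiv : Tendsto (deriv W) (𝓝[≠] 0) (𝓝 0) := by
    rcases hdq.lt_or_eq with hlt | heq
    · exact hA.tendsto_deriv_minimizer_of_dot_pos ha₁ hb₁ ha₂ hb₂ hc₁ hc₂ hW hmin hlim hp1 hlt
    · have hqp : q = (q.1 / wstar.2) • p := by
        have h0 : wstar.1 * q.1 + wstar.2 * q.2 = 0 := heq.symm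
        rw [hp]
        refine Prod.ext ?_ ?_
        · simp only [Prod.smul_fst, smul_eq_mul]
          field_simp
        · simp only [Prod.smul_snd, smul_eq_mul]
          field_simp
          linarith
      have hr : q.1 / wstar.2 ≠ 0 := fun h => hq (by rw [hqp, h, zero_smul])
      rcases hr.lt_or_gt with hneg | hpos'
      · exact hA.tendsto_deriv_minimizer_of_antiparallel ha₁ hb₁ ha₂ hb₂ hc₁ hc₂ hW hmin hlim
          hp1 hneg hqp
      · exact hA.tendsto_deriv_minimizer_of_parallel ha₁ hb₁ ha₂ hb₂ hc₁ hc₂ hW hmin hlim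
          hp1 hpos' hqp
  have hC : ContDiff ℝ 1 W := contDiff_one_of_tendsto_deriv
    (fun ε hε => hA.contDiffAt_minimizer ha₁ hb₁ ha₂ hb₂ hc₁ hc₂ hW hε)
    (by rw [ContinuousAt, hW0]; exact hW0lim) hderiv
  exact ⟨W, hW, hW0, hC.continuous, fun ε _ => hC.contDiffAt, Set.univ, univ_mem, hC.contDiffOn⟩
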